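/- (Vanishing of higher eigenstates) Let Q solve ω(H_y-2)Q - ∂_z²Q - Q³ = -μQ with μ ≥ 0, and suppose ‖Q³‖_{L²(ℝ³)} ≤ K. Then ‖(H_y - 2)Q‖_{L²(ℝ³)} ≤ K/ω, and consequently ‖P₁Q‖_{L²(ℝ³)} ≤ K/((Λ₁-2)ω) where Λ₁ = 4 is the second Hermite eigenvalue. -/

import Mathlib

open MeasureTheory

noncomputable section

def Phi0 (y : ℝ × ℝ) : ℝ :=
  (Real.sqrt Real.pi)⁻¹ * Real.exp (-(y.1 ^ 2 + y.2 ^ 2) / 2)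

/-- Second directional derivative of `f` in direction `v`. -/
def d2 (f : (ℝ × ℝ) × ℝ → ℝ) (v x : (ℝ × ℝ) × ℝ) : ℝ :=
  fderiv ℝ (fun x => fderiv ℝ f x v) x v

/-- The 2d Hermite operator `H_y = -Δ_y + |y|²` acting fiberwise over `z`. -/
def hermiteY (f : (ℝ × ℝ) × ℝ → ℝ) (x : (ℝ × ℝ) × ℝ) : ℝ :=
  -(d2 f ((1, 0), 0) x + d2 f ((0, 1), 0) x) + (x.1.1 ^ 2 + x.1.2 ^ 2) * f x

/-- The projection onto the Hermite ground state in `y`, fibered over `z`. -/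
def P0 (f : (ℝ × ℝ) × ℝ → ℝ) (x : (ℝ × ℝ) × ℝ) : ℝ :=
  (∫ y : ℝ × ℝ, f (y, x.2) * Phi0 y) * Phi0 x.1

/-- The projection onto the higher Hermite modes, `P₁ = 1 - P₀`. -/
def P1 (f : (ℝ × ℝ) × ℝ → ℝ) (x : (ℝ × ℝ) × ℝ) : ℝ := f x - P0 f x

/-- `L²(ℝ³)` norm. -/
def L2norm (f : (ℝ × ℝ) × ℝ → ℝ) : ℝ :=
  Real.sqrt (∫ x : (ℝ × ℝ) × ℝ, f x ^ 2)

end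

set_option linter.all false

namespace Aux16

/-- Abstract algebra of the harmonic oscillator. -/
theorem abstract_bounds {S : Type*} [AddCommGroup S] [Module ℝ S]
    (B : S →ₗ[ℝ] S →ₗ[ℝ] ℝ) (hsymm : ∀ f g, B f g = B g f) (hpos : ∀ f, 0 ≤ B f f)
    (D1 D2 D3 M1 M2 : S →ₗ[ℝ] S)
    (hD1 : ∀ f g, B (D1 f) g = - B f (D1 g))
    (hD2 : ∀ f g, B (D2 f) g = - B f (D2 g))
    (hD3 : ∀ f g, B (D3 f) g = - B f (D3 g))
    (hM1 : ∀ f g, B (M1 f) g = B f (M1 g))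
    (hM2 : ∀ f g, B (M2 f) g = B f (M2 g))
    (h11 : ∀ f, D1 (M1 f) = M1 (D1 f) + f)
    (h22 : ∀ f, D2 (M2 f) = M2 (D2 f) + f)
    (h12 : ∀ f, D1 (M2 f) = M2 (D1 f))
    (h21 : ∀ f, D2 (M1 f) = M1 (D2 f))
    (h31 : ∀ f, D3 (M1 f) = M1 (D3 f))
    (h32 : ∀ f, D3 (M2 f) = M2 (D3 f))
    (hMM : ∀ f, M1 (M2 f) = M2 (M1 f))
    (hDD : ∀ f, D1 (D2 f) = D2 (D1 f))
    (hDD1 : ∀ f, D1 (D3 f) = D3 (D1 f))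
    (hDD2 : ∀ f, D2 (D3 f) = D3 (D2 f))
    (Q AQ : S)
    (hA : AQ = -(D1 (D1 Q) + D2 (D2 Q)) + (M1 (M1 Q) + M2 (M2 Q)) - (2 : ℝ) • Q) :
    2 * (B (D1 Q + M1 Q) (D1 Q + M1 Q) + B (D2 Q + M2 Q) (D2 Q + M2 Q)) ≤ B AQ AQ ∧
    ∀ ω μ : ℝ, 0 < ω → 0 ≤ μ → ω ^ 2 * B AQ AQ ≤
      B (ω • AQ - D3 (D3 Q) + μ • Q) (ω • AQ - D3 (D3 Q) + μ • Q) := by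
  set A : S → S := fun f => -(D1 (D1 f) + D2 (D2 f)) + (M1 (M1 f) + M2 (M2 f)) - (2 : ℝ) • f with hAdef
  set a1 : S → S := fun f => D1 f + M1 f with ha1
  set a2 : S → S := fun f => D2 f + M2 f with ha2
  have key : ∀ f g, B (A f) g = B (a1 f) (a1 g) + B (a2 f) (a2 g) := by
    intro f g
    have e : A f = (M1 (a1 f) - D1 (a1 f)) + (M2 (a2 f) - D2 (a2 f)) := by
      simp only [hAdef, ha1, ha2, map_add, h11, h22]
      module
    rw [e]
    simp only [map_add, map_sub, LinearMap.add_apply, LinearMap.sub_apply, hD1, hD2, hM1, hM2, ha1, ha2]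
    ring
  have c1 : ∀ f, a1 (A f) = A (a1 f) + (2 : ℝ) • a1 f := by
    intro f
    simp only [hAdef, ha1, ha2, map_add, map_sub, map_neg, map_smul, h11, h22, h12, h21, hMM, hDD]
    module
  have c2 : ∀ f, a2 (A f) = A (a2 f) + (2 : ℝ) • a2 f := by
    intro f
    simp only [hAdef, ha1, ha2, map_add, map_sub, map_neg, map_smul, h11, h22, h12, h21, hMM, hDD]
    module
  have hAQ : AQ = A Q := hA
  have posA : ∀ f, 0 ≤ B (A f) f := fun f => by
    rw [key]; exact add_nonneg (hpos _) (hpos _)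
  refine ⟨?_, ?_⟩
  · have h1 := posA (a1 Q)
    have h2 := posA (a2 Q)
    have : B AQ AQ = B (A (a1 Q)) (a1 Q) + B (A (a2 Q)) (a2 Q)
        + 2 * (B (a1 Q) (a1 Q) + B (a2 Q) (a2 Q)) := by
      rw [hAQ, key, c1, c2]
      simp only [map_add, map_smul, smul_eq_mul, hsymm (a1 Q) (A (a1 Q)), hsymm (a2 Q) (A (a2 Q))]
      ring
    change 2 * (B (a1 Q) (a1 Q) + B (a2 Q) (a2 Q)) ≤ _
    linarith
  · intro ω μ hω hμ
    have e3 : B (A Q) (D3 (D3 Q)) = - B (A (D3 Q)) (D3 Q) := by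
      rw [hsymm, hD3, hsymm]
      congr 2
      simp only [hAdef, map_add, map_sub, map_neg, map_smul, h31, h32, hDD1, hDD2]
    have p1 := posA Q
    have p3 := posA (D3 Q)
    have pR := hpos (μ • Q - D3 (D3 Q))
    have : B (ω • AQ - D3 (D3 Q) + μ • Q) (ω • AQ - D3 (D3 Q) + μ • Q)
        = ω ^ 2 * B AQ AQ + 2 * ω * (μ * B (A Q) Q + B (A (D3 Q)) (D3 Q))
          + B (μ • Q - D3 (D3 Q)) (μ • Q - D3 (D3 Q)) := by
      rw [← hAQ] at e3 ⊢
      simp only [map_add, map_sub, map_smul, LinearMap.add_apply, LinearMap.sub_apply,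
        LinearMap.smul_apply, smul_eq_mul, hsymm _ AQ, e3]
      ring
    rw [this]
    have : 0 ≤ 2 * ω * (μ * B (A Q) Q + B (A (D3 Q)) (D3 Q)) := by positivity
    linarith

open LineDeriv SchwartzMap

abbrev E3 := (ℝ × ℝ) × ℝ

theorem haar2 : (volume : Measure (ℝ × ℝ)).IsAddHaarMeasure :=
  Measure.prod.instIsAddHaarMeasure (volume : Measure ℝ) (volume : Measure ℝ)

instance haar3 : (volume : Measure E3).IsAddHaarMeasure :=
  haveI := haar2
  Measure.prod.instIsAddHaarMeasure (volume : Measure (ℝ × ℝ)) (volume : Measure ℝ)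

noncomputable def Mop (l : E3 →L[ℝ] ℝ) : SchwartzMap E3 ℝ →ₗ[ℝ] SchwartzMap E3 ℝ :=
  (SchwartzMap.smulLeftCLM ℝ (fun x => l x)).toLinearMap

theorem Mop_apply (l : E3 →L[ℝ] ℝ) (f : SchwartzMap E3 ℝ) (x : E3) : Mop l f x = l x * f x := by
  simp only [Mop, ContinuousLinearMap.coe_coe]
  rw [SchwartzMap.smulLeftCLM_apply_apply (by fun_prop)]
  rfl

noncomputable def Dop (v : E3) : SchwartzMap E3 ℝ →ₗ[ℝ] SchwartzMap E3 ℝ :=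
  (lineDerivOpCLM ℝ (SchwartzMap E3 ℝ) v).toLinearMap

theorem Dop_apply (v : E3) (f : SchwartzMap E3 ℝ) (x : E3) : Dop v f x = fderiv ℝ f x v := rfl

theorem Dop_Dop_apply (v w : E3) (f : SchwartzMap E3 ℝ) (x : E3) :
    Dop v (Dop w f) x = fderiv ℝ (fun x => fderiv ℝ f x w) x v := rfl

theorem Dop_comm (v w : E3) (f : SchwartzMap E3 ℝ) : Dop v (Dop w f) = Dop w (Dop v f) := by
  ext x
  rw [Dop_Dop_apply, Dop_Dop_apply]
  have hd : DifferentiableAt ℝ (fderiv ℝ f) x :=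
    ((f.smooth 2).fderiv_right (m := 1) (by norm_num)).differentiable (by norm_num) x
  rw [fderiv_clm_apply hd (by fun_prop), fderiv_clm_apply hd (by fun_prop)]
  simp
  exact ((f.smooth 2).contDiffAt.isSymmSndFDerivAt (by simp)) v w

theorem Dop_Mop (v : E3) (l : E3 →L[ℝ] ℝ) (f : SchwartzMap E3 ℝ) :
    Dop v (Mop l f) = Mop l (Dop v f) + l v • f := by
  ext x
  have e : (⇑(Mop l f) : E3 → ℝ) = fun x => l x * f x := funext (Mop_apply l f)
  simp only [_root_.add_apply, _root_.smul_apply, Mop_apply, Dop_apply, e]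
  rw [fderiv_fun_mul (by fun_prop) f.differentiableAt]
  simp
  ring

theorem integrable_mul (f g : SchwartzMap E3 ℝ) : Integrable (fun x => f x * g x) := by
  have := (SchwartzMap.pairing (ContinuousLinearMap.mul ℝ ℝ) f g).integrable (μ := volume)
  exact this

noncomputable def Bf : SchwartzMap E3 ℝ →ₗ[ℝ] SchwartzMap E3 ℝ →ₗ[ℝ] ℝ :=
  LinearMap.mk₂ ℝ (fun f g => ∫ x, f x * g x)
    (fun f g h => by
      simp only [_root_.add_apply, add_mul]
      exact integral_add (integrable_mul _ _) (integrable_mul _ _))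
    (fun c f g => by
      simp only [_root_.smul_apply, smul_eq_mul, mul_assoc]
      exact integral_const_mul _ _)
    (fun f g h => by
      simp only [_root_.add_apply, mul_add]
      exact integral_add (integrable_mul _ _) (integrable_mul _ _))
    (fun c f g => by
      simp only [_root_.smul_apply, smul_eq_mul, mul_left_comm _ c]
      exact integral_const_mul _ _)

theorem Bf_apply (f g : SchwartzMap E3 ℝ) : Bf f g = ∫ x, f x * g x := rfl

theorem concrete_bounds (Q : SchwartzMap E3 ℝ) :
    ∃ AQ : SchwartzMap E3 ℝ, 
    (∀ x, AQ x = -(fderiv ℝ (fun x => fderiv ℝ Q x ((1,0),0)) x ((1,0),0) + 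
        fderiv ℝ (fun x => fderiv ℝ Q x ((0,1),0)) x ((0,1),0)) + (x.1.1 ^ 2 + x.1.2 ^ 2) * Q x
        - 2 * Q x) ∧ 
    2 * ((∫ x : E3, (fderiv ℝ Q x ((1,0),0) + x.1.1 * Q x) ^ 2)
      + ∫ x : E3, (fderiv ℝ Q x ((0,1),0) + x.1.2 * Q x) ^ 2) ≤ ∫ x, AQ x ^ 2 ∧
    ∀ ω μ : ℝ, 0 < ω → 0 ≤ μ → ω ^ 2 * ∫ x, AQ x ^ 2 ≤
      ∫ x, (ω * AQ x - fderiv ℝ (fun x => fderiv ℝ Q x ((0,0),1)) x ((0,0),1) + μ * Q x) ^ 2 := by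
  let l1 : E3 →L[ℝ] ℝ := (ContinuousLinearMap.fst ℝ ℝ ℝ).comp (ContinuousLinearMap.fst ℝ (ℝ × ℝ) ℝ)
  let l2 : E3 →L[ℝ] ℝ := (ContinuousLinearMap.snd ℝ ℝ ℝ).comp (ContinuousLinearMap.fst ℝ (ℝ × ℝ) ℝ)
  let D1 := Dop ((1,0),0)
  let D2 := Dop ((0,1),0)
  let D3 := Dop ((0,0),1)
  let M1 := Mop l1
  let M2 := Mop l2
  have hD : ∀ v f g, Bf (Dop v f) g = - Bf f (Dop v g) := by
    intro v f g
    have := SchwartzMap.integral_mul_lineDerivOp_right_eq_neg_left (μ := volume) f g v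
    rw [Bf_apply, Bf_apply]
    change _ = - ∫ x, f x * (∂_{v} g) x
    rw [this, neg_neg]; rfl
  have hM : ∀ l f g, Bf (Mop l f) g = Bf f (Mop l g) := by
    intro l f g
    simp only [Bf_apply, Mop_apply]
    congr 1; ext x; ring
  refine ⟨-(D1 (D1 Q) + D2 (D2 Q)) + (M1 (M1 Q) + M2 (M2 Q)) - (2 : ℝ) • Q, ?_, ?_⟩
  · intro x
    simp only [_root_.add_apply, _root_.sub_apply, _root_.neg_apply,
      _root_.smul_apply, M1, M2, Mop_apply, D1, D2, Dop_Dop_apply, smul_eq_mul]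
    simp [l1, l2]
    ring
  have := abstract_bounds Bf (fun f g => by simp only [Bf_apply, mul_comm])
    (fun f => by rw [Bf_apply]; exact integral_nonneg fun x => mul_self_nonneg _)
    D1 D2 D3 M1 M2 (hD _) (hD _) (hD _) (hM _) (hM _)
    (fun f => by simp [D1, M1, l1, Dop_Mop]) (fun f => by simp [D2, M2, l2, Dop_Mop])
    (fun f => by simp [D1, M2, l2, Dop_Mop]) (fun f => by simp [D2, M1, l1, Dop_Mop])
    (fun f => by simp [D3, M1, l1, Dop_Mop]) (fun f => by simp [D3, M2, l2, Dop_Mop])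
    (fun f => by ext x; simp only [M1, M2, Mop_apply]; ring)
    (Dop_comm _ _) (Dop_comm _ _) (Dop_comm _ _) Q _ rfl
  simp only [Bf_apply, ← pow_two] at this
  simp only [_root_.add_apply, _root_.sub_apply, 
      _root_.smul_apply, M1, M2, Mop_apply, smul_eq_mul] at this ⊢
  exact this

end Aux16

namespace Aux16

theorem int_lin {X : Type*} [MeasurableSpace X] {m : Measure X} {F G H K : X → ℝ} (T : X → ℝ)
    (hF : Integrable F m) (hG : Integrable G m) (hH : Integrable H m) (hK : Integrable K m)
    (a b c d : ℝ) (hT : ∀ x, T x = a * F x + b * G x + c * H x + d * K x) :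
    ∫ x, T x ∂m = a * (∫ x, F x ∂m) + b * (∫ x, G x ∂m) + c * (∫ x, H x ∂m)
      + d * (∫ x, K x ∂m) := by
  have h1 := hF.const_mul a
  have h2 := hG.const_mul b
  have h3 := hH.const_mul c
  have h4 := hK.const_mul d
  have h12 : Integrable (fun x => a * F x + b * G x) m := h1.add h2
  have h123 : Integrable (fun x => a * F x + b * G x + c * H x) m := h12.add h3
  rw [← integral_const_mul, ← integral_const_mul, ← integral_const_mul, ← integral_const_mul,
    ← integral_add h1 h2, ← integral_add h12 h3, ← integral_add h123 h4]
  exact integral_congr_ae (Filter.Eventually.of_forall hT)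

theorem w_le_one (x : ℝ) : (1 + x ^ 2)⁻¹ ≤ 1 := inv_le_one_of_one_le₀ (by nlinarith [sq_nonneg x])
theorem w_pos (x : ℝ) : 0 < (1 + x ^ 2)⁻¹ := by positivity

def Dec (F : ℝ → ℝ) : Prop := Continuous F ∧ ∃ C, ∀ x, |F x| ≤ C * (1 + x ^ 2)⁻¹

theorem Dec.integrable {F : ℝ → ℝ} (h : Dec F) : Integrable F := by
  obtain ⟨hc, C, hC⟩ := h
  exact (integrable_inv_one_add_sq.const_mul C).mono' hc.aestronglyMeasurable
    (Filter.Eventually.of_forall hC)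

theorem Dec.mul {F G : ℝ → ℝ} (hF : Dec F) (hG : Dec G) : Dec (fun x => F x * G x) := by
  obtain ⟨hc, C, hC⟩ := hF
  obtain ⟨hc', C', hC'⟩ := hG
  refine ⟨hc.mul hc', C * C', fun x => ?_⟩
  rw [abs_mul]
  have h0 := w_pos x
  have h1 := w_le_one x
  have hC0 : 0 ≤ C * (1 + x ^ 2)⁻¹ := (abs_nonneg _).trans (hC x)
  have hC1 : 0 ≤ C := nonneg_of_mul_nonneg_left hC0 h0
  have hC0' : 0 ≤ C' * (1 + x ^ 2)⁻¹ := (abs_nonneg _).trans (hC' x)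
  have hC1' : 0 ≤ C' := nonneg_of_mul_nonneg_left hC0' h0
  calc |F x| * |G x| ≤ (C * (1 + x ^ 2)⁻¹) * (C' * (1 + x ^ 2)⁻¹) :=
        mul_le_mul (hC x) (hC' x) (abs_nonneg _) hC0
    _ = (C * C' * (1 + x ^ 2)⁻¹) * (1 + x ^ 2)⁻¹ := by ring
    _ ≤ (C * C' * (1 + x ^ 2)⁻¹) * 1 := by gcongr
    _ = _ := by ring

theorem Dec.add {F G : ℝ → ℝ} (hF : Dec F) (hG : Dec G) : Dec (fun x => F x + G x) := by
  obtain ⟨hc, C, hC⟩ := hF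
  obtain ⟨hc', C', hC'⟩ := hG
  refine ⟨hc.add hc', C + C', fun x => ?_⟩
  rw [add_mul]
  exact (abs_add_le _ _).trans (add_le_add (hC x) (hC' x))

theorem Dec.const_mul {F : ℝ → ℝ} (hF : Dec F) (c : ℝ) : Dec (fun x => c * F x) := by
  obtain ⟨hc, C, hC⟩ := hF
  refine ⟨by fun_prop, |c| * C, fun x => ?_⟩
  rw [abs_mul, mul_assoc]
  exact mul_le_mul_of_nonneg_left (hC x) (abs_nonneg _)

theorem Dec.sub {F G : ℝ → ℝ} (hF : Dec F) (hG : Dec G) : Dec (fun x => F x - G x) := by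
  have := hF.add (hG.const_mul (-1))
  simpa [sub_eq_add_neg] using this

theorem abs_le_sq (x : ℝ) : |x| ≤ 1 + x ^ 2 := by
  rw [abs_le]; constructor <;> nlinarith [sq_nonneg (x-1), sq_nonneg (x+1)]

/-- a bound with square weight gives two Dec functions -/
theorem dec_of_sq {F : ℝ → ℝ} (hc : Continuous F) {C : ℝ}
    (h : ∀ x, |F x| ≤ C * ((1 + x ^ 2)⁻¹) ^ 2) : Dec F ∧ Dec (fun x => x * F x) := by
  have hC1 : 0 ≤ C := by
    have := (abs_nonneg _).trans (h 0); simpa using this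
  refine ⟨⟨hc, C, fun x => (h x).trans ?_⟩, by fun_prop, C, fun x => ?_⟩
  · have h0 := w_pos x
    have h1 := w_le_one x
    rw [pow_two, ← mul_assoc]
    exact mul_le_of_le_one_right (by positivity) h1
  · rw [abs_mul]
    calc |x| * |F x| ≤ (1 + x ^ 2) * (C * ((1 + x ^ 2)⁻¹) ^ 2) :=
          mul_le_mul (abs_le_sq x) (h x) (abs_nonneg _) (by positivity)
      _ = _ := by field_simp

theorem poin0 (f f' : ℝ → ℝ) (hf : ∀ x, HasDerivAt f (f' x) x) (hf' : Dec f') (C : ℝ)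
    (hC : ∀ x, |f x| ≤ C * ((1 + x ^ 2)⁻¹) ^ 3)
    (h0 : ∫ x, f x * Real.exp (-x ^ 2 / 2) = 0) :
    2 * ∫ x, f x ^ 2 ≤ ∫ x, (f' x + x * f x) ^ 2 := by
  have hfc : Continuous f := continuous_iff_continuousAt.2 fun x => (hf x).continuousAt
  have hC1 : 0 ≤ C := by
    have := (abs_nonneg _).trans (hC 0); simpa using this
  have hC2 : ∀ x, |f x| ≤ C * ((1 + x ^ 2)⁻¹) ^ 2 := fun x => (hC x).trans (by
    have h0 := w_pos x
    have h1 := w_le_one x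
    exact mul_le_mul_of_nonneg_left (pow_le_pow_of_le_one h0.le h1 (by norm_num)) hC1)
  obtain ⟨df, dxf⟩ := dec_of_sq hfc hC2
  set g : ℝ → ℝ := fun x => f x * Real.exp (-x ^ 2 / 2) with hg
  have hgc : Continuous g := by fun_prop
  have hgle : ∀ t x, x ^ 2 ≤ t ^ 2 → Real.exp (x ^ 2 / 2) * |g t| ≤
      C * ((1 + x ^ 2)⁻¹) ^ 2 * (1 + t ^ 2)⁻¹ := by
    intro t x hxt
    have e1 : Real.exp (x ^ 2 / 2) * |g t| = |f t| * Real.exp (x ^ 2 / 2 + -t ^ 2 / 2) := by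
      rw [hg, abs_mul, Real.abs_exp, Real.exp_add]; ring
    rw [e1]
    have e2 : Real.exp (x ^ 2 / 2 + -t ^ 2 / 2) ≤ 1 := Real.exp_le_one_iff.2 (by linarith)
    calc |f t| * Real.exp (x ^ 2 / 2 + -t ^ 2 / 2) ≤ |f t| * 1 := by gcongr
      _ ≤ C * ((1 + t ^ 2)⁻¹) ^ 3 := by rw [mul_one]; exact hC t
      _ = C * ((1 + t ^ 2)⁻¹) ^ 2 * (1 + t ^ 2)⁻¹ := by ring
      _ ≤ _ := by gcongr
  have hgint : Integrable g := by
    refine Dec.integrable ⟨hgc, C, fun x => ?_⟩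
    have := hgle x 0 (by nlinarith [sq_nonneg x])
    simpa using this
  set G : ℝ → ℝ := fun x => - ∫ t in Set.Iic x, g t with hG
  have hGd : ∀ x, HasDerivAt G (- g x) x := by
    intro x
    have e : G = fun x => -((∫ t in (0:ℝ)..x, g t) + ∫ t in Set.Iic (0:ℝ), g t) := by
      funext x
      rw [hG]
      simp only
      rw [← intervalIntegral.integral_Iic_sub_Iic hgint.integrableOn hgint.integrableOn]
      ring
    rw [e]
    exact ((intervalIntegral.integral_hasDerivAt_right (hgint.intervalIntegrable)
      (hgc.stronglyMeasurableAtFilter _ _) hgc.continuousAt).add_const _).neg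
  have hG2 : ∀ x, G x = ∫ t in Set.Ioi x, g t := by
    intro x
    have := intervalIntegral.integral_Iic_add_Ioi (b := x) hgint.integrableOn hgint.integrableOn
    rw [h0] at this
    rw [hG]; simp only; linarith
  set I : ℝ := ∫ t : ℝ, (1 + t ^ 2)⁻¹ with hI
  set u : ℝ → ℝ := fun x => Real.exp (x ^ 2 / 2) * G x with hu
  have hset : ∀ x (s : Set ℝ), MeasurableSet s → (∀ t ∈ s, x ^ 2 ≤ t ^ 2) →
      Real.exp (x ^ 2 / 2) * |∫ t in s, g t| ≤ C * I * ((1 + x ^ 2)⁻¹) ^ 2 := by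
    intro x s hs hst
    calc Real.exp (x ^ 2 / 2) * |∫ t in s, g t| ≤ Real.exp (x ^ 2 / 2) * ∫ t in s, |g t| := by
          gcongr; exact abs_integral_le_integral_abs
      _ = ∫ t in s, Real.exp (x ^ 2 / 2) * |g t| := (integral_const_mul _ _).symm
      _ ≤ ∫ t in s, C * ((1 + x ^ 2)⁻¹) ^ 2 * (1 + t ^ 2)⁻¹ := by
          refine setIntegral_mono_on (hgint.abs.const_mul _).integrableOn
            (integrable_inv_one_add_sq.const_mul _).integrableOn hs fun t ht => hgle t x (hst t ht)
      _ ≤ ∫ t, C * ((1 + x ^ 2)⁻¹) ^ 2 * (1 + t ^ 2)⁻¹ := by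
          refine setIntegral_le_integral (integrable_inv_one_add_sq.const_mul _)
            (Filter.Eventually.of_forall fun t => ?_)
          simp only [Pi.zero_apply]; positivity
      _ = _ := by rw [integral_const_mul]; ring
  have hub : ∀ x, |u x| ≤ C * I * ((1 + x ^ 2)⁻¹) ^ 2 := by
    intro x
    rw [hu]; simp only [abs_mul, Real.abs_exp]
    rcases le_total 0 x with hx | hx
    · rw [hG2]
      exact hset x _ measurableSet_Ioi fun t ht => by
        have : x < t := ht
        nlinarith
    · rw [hG]; simp only [abs_neg]
      exact hset x _ measurableSet_Iic fun t ht => by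
        have : t ≤ x := ht
        nlinarith
  have hud : ∀ x, HasDerivAt u (x * u x - f x) x := by
    intro x
    have h1 : HasDerivAt (fun x : ℝ => x ^ 2 / 2) x x := by
      have := (hasDerivAt_pow 2 x).div_const 2
      convert! this using 1; simp
    have := h1.exp.mul (hGd x)
    convert! this using 1
    have e : Real.exp (x ^ 2 / 2) * Real.exp (-x ^ 2 / 2) = 1 := by
      rw [← Real.exp_add]; ring_nf; simp
    simp only [hu, hg]
    linear_combination f x * e
  have huc : Continuous u := continuous_iff_continuousAt.2 fun x => (hud x).continuousAt
  obtain ⟨du, dxu⟩ := dec_of_sq huc hub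
  have du' : Dec (fun x => x * u x - f x) := dxu.sub df
  have i1 : ∫ x, f x * (x * u x - f x) = - ∫ x, f' x * u x :=
    integral_mul_deriv_eq_deriv_mul_of_integrable (fun x _ => hf x) (fun x _ => hud x)
      (df.mul du').integrable (hf'.mul du).integrable (df.mul du).integrable
  have i2 : ∫ x, (x * u x) * (x * u x - f x) = - ∫ x, (1 * u x + x * (x * u x - f x)) * u x :=
    integral_mul_deriv_eq_deriv_mul_of_integrable
      (fun x _ => (hasDerivAt_id' x).mul (hud x)) (fun x _ => hud x)
      (dxu.mul du').integrable 
      (by 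
        have := ((du.mul du).add (dxu.mul du')).integrable
        refine this.congr (Filter.Eventually.of_forall fun x => ?_)
        simp only [Pi.mul_apply]; ring) (dxu.mul du).integrable
  -- expand
  have Iff := (df.mul df).integrable
  have Ifxu := (df.mul dxu).integrable
  have If'u := (hf'.mul du).integrable
  have Iuu := (du.mul du).integrable
  have Ixx := (dxu.mul dxu).integrable
  have e1 : ∫ x, f x * (x * u x - f x) = (∫ x, f x * (x * u x)) - ∫ x, f x * f x := by
    rw [← integral_sub Ifxu Iff]; congr 1; ext x; ring
  have e2 : ∫ x, (x * u x) * (x * u x - f x) = (∫ x, (x * u x) * (x * u x)) - ∫ x, f x * (x * u x) := by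
    rw [← integral_sub Ixx Ifxu]; congr 1; ext x; ring
  have e3 : ∫ x, (1 * u x + x * (x * u x - f x)) * u x
      = (∫ x, u x * u x) + ((∫ x, (x * u x) * (x * u x)) - ∫ x, f x * (x * u x)) := by
    rw [int_lin _ Iuu Ixx Ifxu Iff 1 1 (-1) 0 (fun x => by ring)]; ring
  have p1 : 0 ≤ ∫ x, (2 * (x * u x) - f x) * (2 * (x * u x) - f x) :=
    integral_nonneg fun x => mul_self_nonneg _
  have e4 : ∫ x, (2 * (x * u x) - f x) * (2 * (x * u x) - f x) =
      4 * ((∫ x, (x * u x) * (x * u x)) - ∫ x, f x * (x * u x)) + ∫ x, f x * f x := by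
    rw [int_lin _ Iff Ixx Ifxu Iuu 1 4 (-4) 0 (fun x => by ring)]; ring
  have daf : Dec (fun x => f' x + x * f x) := hf'.add dxf
  have p2 : 0 ≤ ∫ x, (f' x + x * f x - 2 * u x) * (f' x + x * f x - 2 * u x) :=
    integral_nonneg fun x => mul_self_nonneg _
  have e5 : ∫ x, (f' x + x * f x - 2 * u x) * (f' x + x * f x - 2 * u x) =
      (∫ x, (f' x + x * f x) ^ 2) + 4 * ((∫ x, u x * u x) - ((∫ x, f' x * u x) + ∫ x, f x * (x * u x))) := by
    have Iaf : Integrable (fun x => (f' x + x * f x) ^ 2) := by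
      simpa only [pow_two] using (daf.mul daf).integrable
    rw [int_lin _ Iaf Iuu If'u Ifxu 1 4 (-4) (-4) (fun x => by ring)]; ring
  simp only [pow_two (f _)]
  linarith

/-- normalized 1d ground state -/
noncomputable def ph (x : ℝ) : ℝ := Real.sqrt (Real.sqrt Real.pi)⁻¹ * Real.exp (-x ^ 2 / 2)

theorem ph_cont : Continuous ph := by unfold ph; fun_prop

theorem ph_deriv (x : ℝ) : HasDerivAt ph (-(x * ph x)) x := by
  have h1 : HasDerivAt (fun x : ℝ => -x ^ 2 / 2) (-x) x := by
    have := (hasDerivAt_pow 2 x).neg.div_const 2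
    convert! this using 1; simp; ring
  have := h1.exp.const_mul (Real.sqrt (Real.sqrt Real.pi)⁻¹)
  convert! this using 1
  simp only [ph]; ring

theorem ph_bound : ∃ C, ∀ x, |ph x| ≤ C * ((1 + x ^ 2)⁻¹) ^ 3 := by
  refine ⟨Real.sqrt (Real.sqrt Real.pi)⁻¹ * (48 * Real.exp (1/2)), fun x => ?_⟩
  rw [ph, abs_mul, Real.abs_exp, abs_of_nonneg (Real.sqrt_nonneg _), mul_assoc]
  gcongr
  have h := Real.pow_div_factorial_le_exp ((1 + x ^ 2) / 2) (by positivity) 3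
  have e : Real.exp ((1 + x ^ 2) / 2) * Real.exp (-x ^ 2 / 2) = Real.exp (1/2) := by
    rw [← Real.exp_add]; ring_nf
  rw [inv_pow, ← div_eq_mul_inv, le_div_iff₀ (by positivity)]
  have h2 := mul_le_mul_of_nonneg_right h (Real.exp_pos (-x ^ 2 / 2)).le
  rw [e] at h2
  simp [Nat.factorial] at h2
  nlinarith

theorem ph_sq : ∫ x, ph x * ph x = 1 := by
  have : ∀ x, ph x * ph x = (Real.sqrt Real.pi)⁻¹ * Real.exp (-1 * x ^ 2) := by
    intro x
    have e : Real.exp (-x ^ 2 / 2) * Real.exp (-x ^ 2 / 2) = Real.exp (-1 * x ^ 2) := by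
      rw [← Real.exp_add]; ring_nf
    have s := Real.mul_self_sqrt (show 0 ≤ (Real.sqrt Real.pi)⁻¹ by positivity)
    rw [ph, ← e]
    linear_combination (Real.exp (-x ^ 2 / 2) * Real.exp (-x ^ 2 / 2)) * s
  simp only [this]
  rw [integral_const_mul, integral_gaussian]
  simp
  have : Real.sqrt Real.pi ≠ 0 := by positivity
  field_simp

theorem pow32 {F : ℝ → ℝ} {C : ℝ} (h : ∀ x, |F x| ≤ C * ((1 + x ^ 2)⁻¹) ^ 3) :
    ∀ x, |F x| ≤ C * ((1 + x ^ 2)⁻¹) ^ 2 := by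
  have hC1 : 0 ≤ C := by
    have := (abs_nonneg _).trans (h 0); simpa using this
  exact fun x => (h x).trans (by
    have h0 := w_pos x
    have h1 := w_le_one x
    exact mul_le_mul_of_nonneg_left (pow_le_pow_of_le_one h0.le h1 (by norm_num)) hC1)

theorem ph_dec : Dec ph ∧ Dec (fun x => x * ph x) := by
  obtain ⟨C, hC⟩ := ph_bound
  exact dec_of_sq ph_cont (pow32 hC)

theorem sub_proj {f : ℝ → ℝ} (df : Dec f) :
    ∫ x, (f x - (∫ t, f t * ph t) * ph x) ^ 2 = (∫ x, f x ^ 2) - (∫ x, f x * ph x) ^ 2 := by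
  set c := ∫ t, f t * ph t with hc
  have I1 : Integrable (fun x => f x ^ 2) := by simpa only [pow_two] using (df.mul df).integrable
  have I2 := (df.mul ph_dec.1).integrable
  have I3 := (ph_dec.1.mul ph_dec.1).integrable
  have : ∫ x, (f x - c * ph x) ^ 2 =
      (∫ x, f x ^ 2) + ((-2 * c) * (∫ x, f x * ph x) + c ^ 2 * ∫ x, ph x * ph x) := by
    rw [int_lin _ I1 I2 I3 I3 1 (-2 * c) (c ^ 2) 0 (fun x => by ring)]; ring
  rw [this, ph_sq, ← hc]; ring

theorem cs_ph {f : ℝ → ℝ} (df : Dec f) : (∫ x, f x * ph x) ^ 2 ≤ ∫ x, f x ^ 2 := by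
  have := sub_proj df
  have h : 0 ≤ ∫ x, (f x - (∫ t, f t * ph t) * ph x) ^ 2 := integral_nonneg fun x => sq_nonneg _
  linarith

theorem poin (f f' : ℝ → ℝ) (hf : ∀ x, HasDerivAt f (f' x) x) (hf' : Dec f') (C : ℝ)
    (hC : ∀ x, |f x| ≤ C * ((1 + x ^ 2)⁻¹) ^ 3) :
    2 * ((∫ x, f x ^ 2) - (∫ x, f x * ph x) ^ 2) ≤ ∫ x, (f' x + x * f x) ^ 2 := by
  have hfc : Continuous f := continuous_iff_continuousAt.2 fun x => (hf x).continuousAt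
  obtain ⟨df, dxf⟩ := dec_of_sq hfc (pow32 hC)
  obtain ⟨C', hC'⟩ := ph_bound
  rw [← sub_proj df]
  set c := ∫ t, f t * ph t with hc
  have := poin0 (fun x => f x - c * ph x) (fun x => f' x - c * (-(x * ph x)))
    (fun x => (hf x).sub ((ph_deriv x).const_mul c))
    (by
      have := hf'.add (ph_dec.2.const_mul c)
      convert! this using 2; ring)
    (C + |c| * C')
    (fun x => by
      calc |f x - c * ph x| ≤ |f x| + |c * ph x| := abs_sub _ _
        _ ≤ C * ((1 + x ^ 2)⁻¹) ^ 3 + |c| * (C' * ((1 + x ^ 2)⁻¹) ^ 3) := by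
            rw [abs_mul]
            exact add_le_add (hC x) (mul_le_mul_of_nonneg_left (hC' x) (abs_nonneg _))
        _ = _ := by ring)
    (by
      have I2 := (df.mul ph_dec.1).integrable
      have I3 := (ph_dec.1.mul ph_dec.1).integrable
      have e : ∫ x, (f x - c * ph x) * ph x = 0 := by
        have : ∫ x, (f x - c * ph x) * ph x = (∫ x, f x * ph x) - c * ∫ x, ph x * ph x := by
          rw [← integral_const_mul, ← integral_sub I2 (I3.const_mul c)]
          congr 1; ext x; ring
        rw [this, ph_sq, ← hc]; ring
      have e2 : ∀ x, (f x - c * ph x) * ph x =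
          Real.sqrt (Real.sqrt Real.pi)⁻¹ * ((f x - c * ph x) * Real.exp (-x ^ 2 / 2)) := by
        intro x; conv_lhs => rw [show (f x - c * ph x) * ph x = (f x - c * ph x) * (Real.sqrt (Real.sqrt Real.pi)⁻¹ * Real.exp (-x ^ 2 / 2)) from rfl]
        ring
      simp only [e2] at e
      rw [integral_const_mul] at e
      have : Real.sqrt (Real.sqrt Real.pi)⁻¹ ≠ 0 := by positivity
      exact (mul_eq_zero.1 e).resolve_left this)
  refine this.trans (le_of_eq ?_)
  congr 1; ext x; ring

end Aux16

namespace Aux16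

def Dec2 (F : ℝ × ℝ → ℝ) : Prop :=
  Continuous F ∧ ∃ C, ∀ p : ℝ × ℝ, |F p| ≤ C * ((1 + p.1 ^ 2)⁻¹ * (1 + p.2 ^ 2)⁻¹)

theorem ww_le_one (p : ℝ × ℝ) : (1 + p.1 ^ 2)⁻¹ * (1 + p.2 ^ 2)⁻¹ ≤ 1 :=
  mul_le_one₀ (w_le_one _) (w_pos _).le (w_le_one _)

theorem Dec2.integrable {F : ℝ × ℝ → ℝ} (h : Dec2 F) : Integrable F := by
  obtain ⟨hc, C, hC⟩ := h
  exact ((integrable_inv_one_add_sq.mul_prod integrable_inv_one_add_sq).const_mul C).mono'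
    hc.aestronglyMeasurable (Filter.Eventually.of_forall hC)

theorem Dec2.mul {F G : ℝ × ℝ → ℝ} (hF : Dec2 F) (hG : Dec2 G) : Dec2 (fun x => F x * G x) := by
  obtain ⟨hc, C, hC⟩ := hF
  obtain ⟨hc', C', hC'⟩ := hG
  refine ⟨hc.mul hc', C * C', fun x => ?_⟩
  rw [abs_mul]
  have h1 := ww_le_one x
  have h0 : 0 < (1 + x.1 ^ 2)⁻¹ * (1 + x.2 ^ 2)⁻¹ := by positivity
  have hF' := hC x
  have hG' := hC' x
  generalize (1 + x.1 ^ 2)⁻¹ * (1 + x.2 ^ 2)⁻¹ = w at h1 h0 hF' hG' ⊢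
  have hC0 : 0 ≤ C * w := (abs_nonneg _).trans hF'
  have hC1 : 0 ≤ C := nonneg_of_mul_nonneg_left hC0 h0
  have hC1' : 0 ≤ C' := nonneg_of_mul_nonneg_left ((abs_nonneg _).trans hG') h0
  calc |F x| * |G x| ≤ (C * w) * (C' * w) :=
        mul_le_mul hF' hG' (abs_nonneg _) hC0
    _ = (C * C' * w) * w := by ring
    _ ≤ (C * C' * w) * 1 := by gcongr
    _ = _ := by ring

theorem Dec2.add {F G : ℝ × ℝ → ℝ} (hF : Dec2 F) (hG : Dec2 G) : Dec2 (fun x => F x + G x) := by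
  obtain ⟨hc, C, hC⟩ := hF
  obtain ⟨hc', C', hC'⟩ := hG
  refine ⟨hc.add hc', C + C', fun x => ?_⟩
  rw [add_mul]
  exact (abs_add_le _ _).trans (add_le_add (hC x) (hC' x))

theorem Dec2.sec {F : ℝ × ℝ → ℝ} (hF : Dec2 F) (b : ℝ) : Dec (fun a => F (a, b)) := by
  obtain ⟨hc, C, hC⟩ := hF
  refine ⟨by fun_prop, C * (1 + b ^ 2)⁻¹, fun a => (hC (a, b)).trans (le_of_eq ?_)⟩
  simp only; ring

def Bd (F : ℝ × ℝ → ℝ) (C : ℝ) : Prop :=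
  Continuous F ∧ ∀ p : ℝ × ℝ, |F p| ≤ C * (((1 + p.1 ^ 2)⁻¹) ^ 3 * ((1 + p.2 ^ 2)⁻¹) ^ 3)

theorem Bd.nonneg {F : ℝ × ℝ → ℝ} {C : ℝ} (h : Bd F C) : 0 ≤ C := by
  have := (abs_nonneg _).trans (h.2 (0, 0)); simpa using this

theorem Bd.dec2 {F : ℝ × ℝ → ℝ} {C : ℝ} (h : Bd F C) :
    Dec2 F ∧ Dec2 (fun p => p.1 * F p) ∧ Dec2 (fun p => p.2 * F p) := by
  have h0 := h.nonneg
  obtain ⟨hc, hC⟩ := h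
  have key : ∀ (p : ℝ × ℝ) (r : ℝ), |r| ≤ (1 + p.1 ^ 2) * (1 + p.2 ^ 2) →
      |r * F p| ≤ C * ((1 + p.1 ^ 2)⁻¹ * (1 + p.2 ^ 2)⁻¹) := by
    intro p r hr
    have h1 := ww_le_one p
    rw [abs_mul]
    calc |r| * |F p| ≤ ((1 + p.1 ^ 2) * (1 + p.2 ^ 2)) *
          (C * (((1 + p.1 ^ 2)⁻¹) ^ 3 * ((1 + p.2 ^ 2)⁻¹) ^ 3)) :=
          mul_le_mul hr (hC p) (abs_nonneg _) (by positivity)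
      _ = C * ((1 + p.1 ^ 2)⁻¹ * (1 + p.2 ^ 2)⁻¹) * ((1 + p.1 ^ 2)⁻¹ * (1 + p.2 ^ 2)⁻¹) := by
          field_simp
      _ ≤ C * ((1 + p.1 ^ 2)⁻¹ * (1 + p.2 ^ 2)⁻¹) * 1 := by gcongr
      _ = _ := by ring
  refine ⟨⟨hc, C, fun p => ?_⟩, ⟨by fun_prop, C, fun p => key p _ ?_⟩,
    ⟨by fun_prop, C, fun p => key p _ ?_⟩⟩
  · have := key p 1 (by rw [abs_one]; nlinarith [sq_nonneg p.1, sq_nonneg p.2, mul_nonneg (sq_nonneg p.1) (sq_nonneg p.2)])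
    simpa using this
  · exact (abs_le_sq _).trans (le_mul_of_one_le_right (by positivity) (by nlinarith [sq_nonneg p.2]))
  · exact (abs_le_sq _).trans (le_mul_of_one_le_left (by positivity) (by nlinarith [sq_nonneg p.1]))

theorem Bd.le_snd {F : ℝ × ℝ → ℝ} {C : ℝ} (h : Bd F C) (a b : ℝ) :
    |F (a, b)| ≤ C * ((1 + b ^ 2)⁻¹) ^ 3 := by
  have h0 := h.nonneg
  refine (h.2 (a, b)).trans ?_
  have := pow_le_one₀ (n := 3) (w_pos a).le (w_le_one a)
  exact mul_le_mul_of_nonneg_left (mul_le_of_le_one_left (by positivity) this) h0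

theorem Bd.le_fst {F : ℝ × ℝ → ℝ} {C : ℝ} (h : Bd F C) (a b : ℝ) :
    |F (a, b)| ≤ C * ((1 + a ^ 2)⁻¹) ^ 3 := by
  have h0 := h.nonneg
  refine (h.2 (a, b)).trans ?_
  have := pow_le_one₀ (n := 3) (w_pos b).le (w_le_one b)
  exact mul_le_mul_of_nonneg_left (mul_le_of_le_one_right (by positivity) this) h0

theorem Bd.le_const {F : ℝ × ℝ → ℝ} {C : ℝ} (h : Bd F C) (a b : ℝ) : |F (a, b)| ≤ C := by
  refine (h.le_snd a b).trans (mul_le_of_le_one_right h.nonneg ?_)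
  exact pow_le_one₀ (n := 3) (w_pos b).le (w_le_one b)

noncomputable def J : ℝ := ∫ a, |ph a|

theorem Bd.marg {F : ℝ × ℝ → ℝ} {C : ℝ} (h : Bd F C) :
    Continuous (fun b => ∫ a, F (a, b) * ph a) ∧
    ∀ b, |∫ a, F (a, b) * ph a| ≤ (C * J) * ((1 + b ^ 2)⁻¹) ^ 3 := by
  have hc := h.1
  have hp := ph_cont
  constructor
  · refine continuous_of_dominated (bound := fun a => C * |ph a|) ?_ ?_ ?_ ?_
    · intro b
      exact Continuous.aestronglyMeasurable (by fun_prop)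
    · intro b
      refine Filter.Eventually.of_forall fun a => ?_
      rw [Real.norm_eq_abs, abs_mul]
      exact mul_le_mul_of_nonneg_right (h.le_const a b) (abs_nonneg _)
    · exact ph_dec.1.integrable.abs.const_mul C
    · exact Filter.Eventually.of_forall fun a => by fun_prop
  · intro b
    refine (abs_integral_le_integral_abs).trans ?_
    have : ∫ a, C * ((1 + b ^ 2)⁻¹) ^ 3 * |ph a| = (C * J) * ((1 + b ^ 2)⁻¹) ^ 3 := by
      rw [integral_const_mul, J]; ring
    rw [← this]
    refine integral_mono ((h.dec2.1.sec b).mul ph_dec.1).integrable.abs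
      (ph_dec.1.integrable.abs.const_mul _) fun a => ?_
    simp only [abs_mul]
    exact mul_le_mul_of_nonneg_right (h.le_snd a b) (abs_nonneg _)

theorem Bd.marg_deriv {g g2 : ℝ × ℝ → ℝ} {C C2 : ℝ} (hg : Bd g C) (hg2 : Bd g2 C2)
    (hd : ∀ a b, HasDerivAt (fun b => g (a, b)) (g2 (a, b)) b) (b : ℝ) :
    HasDerivAt (fun b => ∫ a, g (a, b) * ph a) (∫ a, g2 (a, b) * ph a) b := by
  have hc := hg.1
  have hc2 := hg2.1
  have hp := ph_cont
  refine (hasDerivAt_integral_of_dominated_loc_of_deriv_le (F := fun b a => g (a, b) * ph a)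
    (F' := fun b a => g2 (a, b) * ph a) (bound := fun a => C2 * |ph a|) (s := Set.univ)
    Filter.univ_mem ?_ ?_ ?_ ?_ ?_ ?_).2
  · exact Filter.Eventually.of_forall fun b => Continuous.aestronglyMeasurable (by fun_prop)
  · exact ((hg.dec2.1.sec b).mul ph_dec.1).integrable
  · exact Continuous.aestronglyMeasurable (by fun_prop)
  · refine Filter.Eventually.of_forall fun a b _ => ?_
    rw [Real.norm_eq_abs, abs_mul]
    exact mul_le_mul_of_nonneg_right (hg2.le_const a b) (abs_nonneg _)
  · exact ph_dec.1.integrable.abs.const_mul _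
  · exact Filter.Eventually.of_forall fun a b _ => (hd a b).mul_const _

theorem ph2_dec : Dec2 (fun p => ph p.1 * ph p.2) := by
  obtain ⟨hc, C, hC⟩ := ph_dec.1
  refine ⟨by fun_prop, C * C, fun p => ?_⟩
  rw [abs_mul]
  calc |ph p.1| * |ph p.2| ≤ (C * (1 + p.1 ^ 2)⁻¹) * (C * (1 + p.2 ^ 2)⁻¹) :=
        mul_le_mul (hC _) (hC _) (abs_nonneg _) ((abs_nonneg _).trans (hC _))
    _ = _ := by ring

theorem fub {F : ℝ × ℝ → ℝ} (h : Integrable F) : ∫ p, F p = ∫ b, ∫ a, F (a, b) :=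
  integral_prod_symm F h

theorem Dec2.sq {F : ℝ × ℝ → ℝ} (h : Dec2 F) : Integrable (fun p => F p ^ 2) := by
  simpa only [pow_two] using (h.mul h).integrable

theorem Dec.sq {F : ℝ → ℝ} (h : Dec F) : Integrable (fun p => F p ^ 2) := by
  simpa only [pow_two] using (h.mul h).integrable

theorem poin2 {g g1 g2 : ℝ × ℝ → ℝ} {C C1 C2 : ℝ} (hg : Bd g C) (hg1 : Bd g1 C1) (hg2 : Bd g2 C2)
    (hd1 : ∀ a b, HasDerivAt (fun a => g (a, b)) (g1 (a, b)) a)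
    (hd2 : ∀ a b, HasDerivAt (fun b => g (a, b)) (g2 (a, b)) b) :
    2 * ∫ p, (g p - (∫ q, g q * (ph q.1 * ph q.2)) * (ph p.1 * ph p.2)) ^ 2 ≤
      (∫ p, (g1 p + p.1 * g p) ^ 2) + ∫ p, (g2 p + p.2 * g p) ^ 2 := by
  set c := ∫ q, g q * (ph q.1 * ph q.2) with hcdef
  obtain ⟨dg, dg', dg''⟩ := hg.dec2
  have dA1 : Dec2 (fun p => g1 p + p.1 * g p) := hg1.dec2.1.add dg'
  have dA2 : Dec2 (fun p => g2 p + p.2 * g p) := hg2.dec2.1.add dg''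
  have Igp := (dg.mul ph2_dec).integrable
  have Ipp := (ph2_dec.mul ph2_dec).integrable
  set k : ℝ → ℝ := fun b => ∫ a, g (a, b) * ph a with hk
  set k' : ℝ → ℝ := fun b => ∫ a, g2 (a, b) * ph a with hk'
  obtain ⟨kc, kb⟩ := hg.marg
  obtain ⟨kc', kb'⟩ := hg2.marg
  have dk : Dec k := (dec_of_sq kc (pow32 kb)).1
  have dxk : Dec (fun x => x * k x) := (dec_of_sq kc (pow32 kb)).2
  have dk' : Dec k' := (dec_of_sq kc' (pow32 kb')).1
  have hkd := hg.marg_deriv hg2 hd2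
  -- the constant
  have ec : c = ∫ b, k b * ph b := by
    rw [hcdef, fub Igp]
    congr 1; ext b
    rw [hk]; simp only
    rw [← integral_mul_const]
    congr 1; ext a; ring
  have epp : ∫ p : ℝ × ℝ, (ph p.1 * ph p.2) * (ph p.1 * ph p.2) = 1 := by
    rw [fub Ipp]
    have : ∀ b, ∫ a, (ph a * ph b) * (ph a * ph b) = ph b * ph b := by
      intro b
      have : ∀ a, (ph a * ph b) * (ph a * ph b) = (ph b * ph b) * (ph a * ph a) := fun a => by ring
      simp only [this]
      rw [integral_const_mul, ph_sq, mul_one]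
    simp only [this]
    exact ph_sq
  have e0 : ∫ p, (g p - c * (ph p.1 * ph p.2)) ^ 2 = (∫ p, g p ^ 2) - c ^ 2 := by
    rw [int_lin _ dg.sq Igp Ipp Ipp 1 (-2 * c) (c ^ 2) 0 (fun x => by ring), epp, ← hcdef]; ring
  -- step 1
  have s1 : 2 * ((∫ p, g p ^ 2) - ∫ b, k b ^ 2) ≤ ∫ p, (g1 p + p.1 * g p) ^ 2 := by
    rw [fub dg.sq, fub dA1.sq, ← integral_sub dg.sq.integral_prod_right dk.sq,
      ← integral_const_mul]
    refine integral_mono ((dg.sq.integral_prod_right.sub dk.sq).const_mul 2)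
      dA1.sq.integral_prod_right fun b => ?_
    exact poin (fun a => g (a, b)) (fun a => g1 (a, b)) (fun a => hd1 a b) (hg1.dec2.1.sec b) C
      (fun a => hg.le_fst a b)
  -- step 2
  have s2 := poin k k' hkd dk' _ kb
  rw [← ec] at s2
  -- step 3
  have s3 : ∫ b, (k' b + b * k b) ^ 2 ≤ ∫ p, (g2 p + p.2 * g p) ^ 2 := by
    rw [fub dA2.sq]
    refine integral_mono (dk'.add dxk).sq dA2.sq.integral_prod_right fun b => ?_
    have e : k' b + b * k b = ∫ a, (g2 (a, b) + b * g (a, b)) * ph a := by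
      have I1 := ((hg2.dec2.1.sec b).mul ph_dec.1).integrable
      have I2 := ((dg.sec b).mul ph_dec.1).integrable
      rw [int_lin _ I1 I2 I2 I2 1 b 0 0 (fun x => by ring)]
      simp only [hk, hk']; ring
    simp only [e]
    exact cs_ph (dA2.sec b)
  rw [e0]
  linarith

theorem schwartz_bd (f : SchwartzMap E3 ℝ) : ∃ C, ∀ z, Bd (fun p => f (p, z)) C := by
  have h := fun x => SchwartzMap.one_add_le_sup_seminorm_apply (𝕜 := ℝ) (m := (12, 0)) (k := 12)
    (n := 0) le_rfl le_rfl f x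
  set C := 2 ^ ((12, 0) : ℕ × ℕ).1 * (Finset.Iic ((12, 0) : ℕ × ℕ)).sup
    (fun m => SchwartzMap.seminorm ℝ (E := E3) (F := ℝ) m.1 m.2) f with hC
  refine ⟨C, fun z => ⟨by have := f.continuous; fun_prop, fun p => ?_⟩⟩
  have hx := h (p, z)
  rw [norm_iteratedFDeriv_zero, Real.norm_eq_abs] at hx
  have n1 : |p.1| ≤ ‖((p, z) : E3)‖ := (norm_fst_le p).trans (norm_fst_le (p, z))
  have n2 : |p.2| ≤ ‖((p, z) : E3)‖ := (norm_snd_le p).trans (norm_fst_le (p, z))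
  set r := ‖((p, z) : E3)‖ with hr
  have q1 : 1 + p.1 ^ 2 ≤ (1 + r) ^ 2 := by
    rw [← sq_abs]; nlinarith [abs_nonneg p.1]
  have q2 : 1 + p.2 ^ 2 ≤ (1 + r) ^ 2 := by
    rw [← sq_abs]; nlinarith [abs_nonneg p.2]
  rw [inv_pow, inv_pow, ← mul_inv, ← div_eq_mul_inv, le_div_iff₀ (by positivity)]
  calc |f (p, z)| * ((1 + p.1 ^ 2) ^ 3 * (1 + p.2 ^ 2) ^ 3)
      ≤ |f (p, z)| * (((1 + r) ^ 2) ^ 3 * ((1 + r) ^ 2) ^ 3) := by gcongr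
    _ = (1 + r) ^ 12 * |f (p, z)| := by ring
    _ ≤ C := hx

theorem poin3 (Q : SchwartzMap E3 ℝ) (z : ℝ) :
    2 * ∫ p : ℝ × ℝ, (Q (p, z) - (∫ q : ℝ × ℝ, Q (q, z) * (ph q.1 * ph q.2)) * (ph p.1 * ph p.2)) ^ 2
      ≤ (∫ p : ℝ × ℝ, (fderiv ℝ Q (p, z) ((1, 0), 0) + p.1 * Q (p, z)) ^ 2)
       + ∫ p : ℝ × ℝ, (fderiv ℝ Q (p, z) ((0, 1), 0) + p.2 * Q (p, z)) ^ 2 := by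
  obtain ⟨C, hC⟩ := schwartz_bd Q
  obtain ⟨C1, hC1⟩ := schwartz_bd (Dop ((1, 0), 0) Q)
  obtain ⟨C2, hC2⟩ := schwartz_bd (Dop ((0, 1), 0) Q)
  refine poin2 (hC z) (hC1 z) (hC2 z) ?_ ?_
  · intro a b
    have h : HasDerivAt (fun a : ℝ => (((a, b), z) : E3)) ((1, 0), 0) a :=
      ((hasDerivAt_id' a).prodMk (hasDerivAt_const a b)).prodMk (hasDerivAt_const a z)
    exact (Q.hasFDerivAt _).comp_hasDerivAt a h
  · intro a b
    have h : HasDerivAt (fun b : ℝ => (((a, b), z) : E3)) ((0, 1), 0) b :=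
      ((hasDerivAt_const b a).prodMk (hasDerivAt_id' b)).prodMk (hasDerivAt_const b z)
    exact (Q.hasFDerivAt _).comp_hasDerivAt b h

theorem fub3 {F : E3 → ℝ} (h : Integrable F) : ∫ x, F x = ∫ z, ∫ p, F (p, z) :=
  integral_prod_symm F h

theorem gap3 (Q : SchwartzMap E3 ℝ) (F : E3 → ℝ)
    (hF : ∀ p z, F (p, z) =
      Q (p, z) - (∫ q : ℝ × ℝ, Q (q, z) * (ph q.1 * ph q.2)) * (ph p.1 * ph p.2)) :
    2 * ∫ x, F x ^ 2 ≤ (∫ x : E3, (fderiv ℝ Q x ((1,0),0) + x.1.1 * Q x) ^ 2)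
      + ∫ x : E3, (fderiv ℝ Q x ((0,1),0) + x.1.2 * Q x) ^ 2 := by
  by_cases hi : Integrable (fun x => F x ^ 2)
  swap
  · rw [integral_undef hi, mul_zero]
    exact add_nonneg (integral_nonneg fun x => sq_nonneg _) (integral_nonneg fun x => sq_nonneg _)
  have I1 : Integrable (fun x : E3 => (fderiv ℝ Q x ((1,0),0) + x.1.1 * Q x) ^ 2) := by
    have := integrable_mul (Dop ((1,0),0) Q + Mop ((ContinuousLinearMap.fst ℝ ℝ ℝ).comp (ContinuousLinearMap.fst ℝ (ℝ × ℝ) ℝ)) Q) (Dop ((1,0),0) Q + Mop ((ContinuousLinearMap.fst ℝ ℝ ℝ).comp (ContinuousLinearMap.fst ℝ (ℝ × ℝ) ℝ)) Q)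
    simp only [← pow_two, _root_.add_apply, Mop_apply, Dop_apply] at this
    exact this
  have I2 : Integrable (fun x : E3 => (fderiv ℝ Q x ((0,1),0) + x.1.2 * Q x) ^ 2) := by
    have := integrable_mul (Dop ((0,1),0) Q + Mop ((ContinuousLinearMap.snd ℝ ℝ ℝ).comp (ContinuousLinearMap.fst ℝ (ℝ × ℝ) ℝ)) Q) (Dop ((0,1),0) Q + Mop ((ContinuousLinearMap.snd ℝ ℝ ℝ).comp (ContinuousLinearMap.fst ℝ (ℝ × ℝ) ℝ)) Q)
    simp only [← pow_two, _root_.add_apply, Mop_apply, Dop_apply] at this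
    exact this
  have J0 : Integrable (fun z => ∫ p, F (p, z) ^ 2) := hi.integral_prod_right
  have J1 := Integrable.integral_prod_right I1
  have J2 := Integrable.integral_prod_right I2
  rw [fub3 hi, fub3 I1, fub3 I2, ← integral_add J1 J2, ← integral_const_mul]
  refine integral_mono (J0.const_mul 2) (J1.add J2) fun z => ?_
  simp only [hF]
  exact poin3 Q z

theorem Phi0_eq (y : ℝ × ℝ) : Phi0 y = ph y.1 * ph y.2 := by
  have s := Real.mul_self_sqrt (show 0 ≤ (Real.sqrt Real.pi)⁻¹ by positivity)
  have e : Real.exp (-(y.1 ^ 2 + y.2 ^ 2) / 2) = Real.exp (-y.1 ^ 2 / 2) * Real.exp (-y.2 ^ 2 / 2) := by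
    rw [← Real.exp_add]; ring_nf
  rw [Phi0, ph, ph, e]
  linear_combination -(Real.exp (-y.1 ^ 2 / 2) * Real.exp (-y.2 ^ 2 / 2)) * s

end Aux16

/-- Vanishing of higher eigenstates: if a Schwartz `Q` solves
`ω(H_y-2)Q - ∂_z²Q - Q³ = -μQ` with `μ ≥ 0` and `‖Q³‖_{L²} ≤ K`, then
`‖(H_y-2)Q‖_{L²} ≤ K/ω` and `‖P₁Q‖_{L²} ≤ K/((Λ₁-2)ω)` with `Λ₁ = 4`. -/
theorem stmt_16 (ω μ K : ℝ) (hω : 0 < ω) (hμ : 0 ≤ μ)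
    (Q : SchwartzMap ((ℝ × ℝ) × ℝ) ℝ)
    (hPDE : ∀ x, ω * (hermiteY (⇑Q) x - 2 * Q x) - d2 (⇑Q) ((0, 0), 1) x - Q x ^ 3
      = -μ * Q x)
    (hK : L2norm (fun x => Q x ^ 3) ≤ K) :
    L2norm (fun x => hermiteY (⇑Q) x - 2 * Q x) ≤ K / ω ∧
    L2norm (P1 (⇑Q)) ≤ K / (((4 : ℝ) - 2) * ω) := by
  obtain ⟨AQ, hAQ, hgap, hbound⟩ := Aux16.concrete_bounds Q
  have eA : (fun x => hermiteY (⇑Q) x - 2 * Q x) = AQ := by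
    funext x; rw [hAQ x]; rfl
  have hK0 : 0 ≤ K := (Real.sqrt_nonneg _).trans hK
  have hQ3 : ∫ x : (ℝ × ℝ) × ℝ, (Q x ^ 3) ^ 2 ≤ K ^ 2 := (Real.sqrt_le_left hK0).1 hK
  have h1 := hbound ω μ hω hμ
  have e3 : ∀ x, ω * AQ x - fderiv ℝ (fun x => fderiv ℝ Q x ((0,0),1)) x ((0,0),1) + μ * Q x
      = Q x ^ 3 := by
    intro x
    have h := hPDE x
    have hx : hermiteY (⇑Q) x - 2 * Q x = AQ x := congrFun eA x
    rw [hx] at h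
    simp only [d2] at h
    linarith
  simp only [e3] at h1
  have h2 : ∫ x, AQ x ^ 2 ≤ (K / ω) ^ 2 := by
    rw [div_pow, le_div_iff₀ (by positivity)]
    linarith
  have hg := Aux16.gap3 Q (P1 (⇑Q)) (fun p z => by
    simp only [P1, P0, Aux16.Phi0_eq])
  refine ⟨?_, ?_⟩
  · rw [eA]
    exact (Real.sqrt_le_left (by positivity)).2 h2
  · refine (Real.sqrt_le_left (by positivity)).2 ?_
    have : (K / ((4 - 2) * ω)) ^ 2 = (K / ω) ^ 2 / 4 := by field_simp; norm_num
    rw [this]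
    linarith
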